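/- Let Ω be a compact Hausdorff topological space, t₀ ∈ Ω, ε ∈ (0,1), and let B := {(1−ε)g + εh : g, h ∈ C(Ω), ‖g‖∞ ≤ 1, ‖h‖∞ ≤ 1, h(t₀) = 0}. Then for every f ∈ C(Ω), f ∈ B if and only if |f(t₀)| ≤ 1 − ε and ‖f‖∞ ≤ 1. -/

import Mathlib

noncomputable section

/-- description of the set `B`. -/
theorem statement11 (Ω : Type*) [TopologicalSpace Ω] [CompactSpace Ω] [T2Space Ω]
    (t₀ : Ω) (ε : ℝ) (hε : ε ∈ Set.Ioo (0:ℝ) 1) (f : C(Ω, ℝ)) :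
    (∃ g h : C(Ω, ℝ), ‖g‖ ≤ 1 ∧ ‖h‖ ≤ 1 ∧ h t₀ = 0 ∧ f = (1 - ε) • g + ε • h) ↔
    (|f t₀| ≤ 1 - ε ∧ ‖f‖ ≤ 1) := by
  obtain ⟨h0, h1⟩ := hε
  have hδ : 0 < 1 - ε := by linarith
  simp only [ContinuousMap.norm_le _ zero_le_one, Real.norm_eq_abs, abs_le]
  constructor
  · rintro ⟨g, h, hg, hh, ht, rfl⟩
    simp only [ContinuousMap.add_apply, ContinuousMap.smul_apply, smul_eq_mul, ht]
    refine ⟨⟨?_, ?_⟩, fun x => ⟨?_, ?_⟩⟩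
    · nlinarith [hg t₀]
    · nlinarith [hg t₀]
    · nlinarith [hg x, hh x]
    · nlinarith [hg x, hh x]
  · rintro ⟨ht, hf⟩
    -- Truncate `f` to `[-(1 - ε), 1 - ε]`; the remainder is bounded by `ε`.
    let c : C(Ω, ℝ) := ⟨fun x => max (-(1 - ε)) (min (f x) (1 - ε)), by fun_prop⟩
    have hc (x : Ω) : c x = max (-(1 - ε)) (min (f x) (1 - ε)) := rfl
    have hc_lower (x : Ω) : -(1 - ε) ≤ c x := le_max_left _ _
    have hc_upper (x : Ω) : c x ≤ 1 - ε := max_le (by linarith) (min_le_right _ _)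
    have hr (x : Ω) : -ε ≤ f x - c x ∧ f x - c x ≤ ε := by
      have := hf x
      rw [hc]
      grind
    refine ⟨(1 - ε)⁻¹ • c, ε⁻¹ • (f - c), fun x => ?_, fun x => ?_, ?_, ?_⟩
    · simp only [ContinuousMap.smul_apply, smul_eq_mul, inv_mul_eq_div]
      rw [le_div_iff₀ hδ, div_le_iff₀ hδ]
      constructor <;> linarith [hc_lower x, hc_upper x]
    · simp only [ContinuousMap.smul_apply, ContinuousMap.sub_apply, smul_eq_mul, inv_mul_eq_div]
      rw [le_div_iff₀ h0, div_le_iff₀ h0]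
      constructor <;> linarith [hr x]
    · have hct : c t₀ = f t₀ := by rw [hc, min_eq_left ht.2, max_eq_right ht.1]
      simp [hct]
    · rw [smul_inv_smul₀ hδ.ne', smul_inv_smul₀ h0.ne', add_sub_cancel]
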